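/- Let k ≥ 3 and let q ∈ [α_k, α_{k+1}). Then (T_{q,0}^{−1}(U_q) ∩ J_q) ∪ (T_{q,1}^{−1}(U_q) ∩ J_q) = {(1 (0)^j (01)^∞)_q : 1 ≤ j ≤ k} ∪ {(0 (1)^j (10)^∞)_q : 1 ≤ j ≤ k}. -/

import Mathlib

noncomputable section

open Set

/-- The map `T_{q,i}(x) = q*x - i` for a binary digit `i`. -/
def Tmap (q : ℝ) (i : Fin 2) (x : ℝ) : ℝ := q * x - ((i : ℕ) : ℝ)

/-- The value `((ε_i)_{i=1}^∞)_q = ∑_{i=1}^∞ ε_i q^{-i}` of a binary sequence in base `q`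
(the sequence is 0-indexed, so digit `ε i` has weight `q^{-(i+1)}`). -/
def seqVal (q : ℝ) (ε : ℕ → Fin 2) : ℝ := ∑' i : ℕ, ((ε i : ℕ) : ℝ) / q ^ (i + 1)

/-- `Σ_q(x)`: the set of `q`-expansions of `x`. -/
def SigmaSet (q x : ℝ) : Set (ℕ → Fin 2) := {ε | x = seqVal q ε}

/-- The interval `I_q = [0, 1/(q-1)]`. -/
def Iq (q : ℝ) : Set ℝ := Icc 0 (1 / (q - 1))

/-- The switch region `S_q = [1/q, 1/(q(q-1))]`. -/
def Sq (q : ℝ) : Set ℝ := Icc (1 / q) (1 / (q * (q - 1)))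

/-- The interval `J_q = [(q+q²)/(q⁴-1), (1+q³)/(q⁴-1)]`. -/
def Jq (q : ℝ) : Set ℝ := Icc ((q + q ^ 2) / (q ^ 4 - 1)) ((1 + q ^ 3) / (q ^ 4 - 1))

/-- Apply the first `n` maps of a sequence of maps to `x`:
`applySeq a n x = (a_{n-1} ∘ ⋯ ∘ a_0)(x)`. -/
def applySeq (a : ℕ → ℝ → ℝ) (n : ℕ) (x : ℝ) : ℝ := (List.range n).foldl (fun y k => a k y) x

/-- `Ω_q(x)`: the set of sequences of maps, each equal to `T_{q,0}` or `T_{q,1}`,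
all of whose partial compositions applied to `x` stay in `I_q`. -/
def OmegaSet (q x : ℝ) : Set (ℕ → ℝ → ℝ) :=
  {a | (∀ n, a n = Tmap q 0 ∨ a n = Tmap q 1) ∧ ∀ n : ℕ, applySeq a (n + 1) x ∈ Iq q}

/-- Apply a finite word of digits to `x` (first letter applied first):
for `a = [a₁, …, aₙ]`, `wordMap q a x = (T_{q,aₙ} ∘ ⋯ ∘ T_{q,a₁})(x)`. -/
def wordMap (q : ℝ) (a : List (Fin 2)) (x : ℝ) : ℝ := a.foldl (fun y i => Tmap q i y) x

/-- A branching sequence for `x`: a finite word whose partial compositions applied to `x`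
stay in `I_q`, and whose full composition maps `x` into the switch region `S_q`. -/
def IsBranching (q x : ℝ) (a : List (Fin 2)) : Prop :=
  (∀ k, k ≤ a.length → wordMap q (a.take k) x ∈ Iq q) ∧ wordMap q a x ∈ Sq q

/-- `x` is a `q` null infinite point: `x ∈ (0,1/(q-1))`, `Ω_q(x)` is infinite, and for every
branching sequence `a` for `x` there is a digit `i` with `Ω_q(T_{q,i}(a(x)))` finite. -/
def NullInfinite (q x : ℝ) : Prop :=
  x ∈ Ioo 0 (1 / (q - 1)) ∧ (OmegaSet q x).Infinite ∧
    ∀ a : List (Fin 2), IsBranching q x a →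
      ∃ i : Fin 2, (OmegaSet q (Tmap q i (wordMap q a x))).Finite

/-- `U_q`: points of `I_q` with exactly one `q`-expansion. -/
def UniqSet (q : ℝ) : Set ℝ := {x | x ∈ Iq q ∧ ∃! ε : ℕ → Fin 2, ε ∈ SigmaSet q x}

/-- `B_{ℵ₀}`: bases `q ∈ (1,2)` for which some `x ∈ (0,1/(q-1))` has exactly countably
infinitely many `q`-expansions. -/
def BAleph0 : Set ℝ :=
  {q | q ∈ Ioo (1 : ℝ) 2 ∧ ∃ x ∈ Ioo (0 : ℝ) (1 / (q - 1)),
    Cardinal.mk ↥(SigmaSet q x) = Cardinal.aleph0}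

/-- The eventually periodic binary sequence `u w^∞`: the finite word `u` followed by
infinitely many repetitions of the finite word `w`. -/
def uwInf (u w : List (Fin 2)) : ℕ → Fin 2 := fun i =>
  if i < u.length then u.getD i 0 else w.getD ((i - u.length) % w.length) 0

/-- The sequence with first digit `d` and tail `ε`. -/
def consSeq (d : Fin 2) (ε : ℕ → Fin 2) : ℕ → Fin 2 := fun n => Nat.casesOn n d ε

lemma fin_two_cast_cases (d : Fin 2) : ((d : ℕ) : ℝ) = 0 ∨ ((d : ℕ) : ℝ) = 1 := by
  fin_cases d <;> simp

lemma fin_two_cast_injective {d e : Fin 2} (h : ((d : ℕ) : ℝ) = ((e : ℕ) : ℝ)) : d = e := by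
  apply Fin.ext
  exact_mod_cast h

lemma hasSum_inv_pow_succ {q : ℝ} (hq : 1 < q) :
    HasSum (fun i : ℕ => 1 / q ^ (i + 1)) (1 / (q - 1)) := by
  have h0 : (0 : ℝ) < q := by linarith
  have h := (hasSum_geometric_of_lt_one (inv_nonneg.2 h0.le) (inv_lt_one_of_one_lt₀ hq)).mul_left q⁻¹
  have hq1 : q - 1 ≠ 0 := by linarith
  have hsum : q⁻¹ * (1 - q⁻¹)⁻¹ = 1 / (q - 1) := by
    rw [show 1 - q⁻¹ = (q - 1) / q by field_simp]
    field_simp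
  rw [hsum] at h
  have hfun : (fun i : ℕ => q⁻¹ * q⁻¹ ^ i) = fun i => 1 / q ^ (i + 1) := by
    ext i
    rw [pow_succ, inv_pow]
    field_simp
  exact hfun ▸ h

lemma summable_digits {q : ℝ} (hq : 1 < q) (ε : ℕ → Fin 2) :
    Summable (fun i : ℕ => ((ε i : ℕ) : ℝ) / q ^ (i + 1)) := by
  have h0 : (0 : ℝ) < q := by linarith
  refine Summable.of_nonneg_of_le (fun i => by positivity) (fun i => ?_)
    (hasSum_inv_pow_succ hq).summable
  rcases fin_two_cast_cases (ε i) with h | h <;> rw [h]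
  gcongr
  norm_num

lemma seqVal_mem_Iq {q : ℝ} (hq : 1 < q) (ε : ℕ → Fin 2) : seqVal q ε ∈ Iq q := by
  have h0 : (0 : ℝ) < q := by linarith
  refine ⟨tsum_nonneg fun i => by positivity, ?_⟩
  rw [← (hasSum_inv_pow_succ hq).tsum_eq]
  refine (summable_digits hq ε).tsum_le_tsum (fun i => ?_) (hasSum_inv_pow_succ hq).summable
  rcases fin_two_cast_cases (ε i) with h | h <;> rw [h]
  gcongr
  norm_num

lemma seqVal_eq_head_add_tail {q : ℝ} (hq : 1 < q) (ε : ℕ → Fin 2) :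
    seqVal q ε = (((ε 0 : ℕ) : ℝ) + seqVal q (fun n => ε (n + 1))) / q := by
  have h0 : (0 : ℝ) < q := by linarith
  unfold seqVal
  rw [(summable_digits hq ε).tsum_eq_zero_add, add_div, ← tsum_div_const]
  congr 1
  · simp
  · congr 1
    ext i
    rw [pow_succ q (i + 1)]
    field_simp

lemma seqVal_consSeq {q : ℝ} (hq : 1 < q) (d : Fin 2) (ε : ℕ → Fin 2) :
    seqVal q (consSeq d ε) = (((d : ℕ) : ℝ) + seqVal q ε) / q :=
  seqVal_eq_head_add_tail hq _

lemma consSeq_injective (d : Fin 2) : Function.Injective (consSeq d) := fun _ _ h =>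
  funext fun n => congrFun h (n + 1)

lemma consSeq_head_tail (ε : ℕ → Fin 2) : consSeq (ε 0) (fun n => ε (n + 1)) = ε := by
  ext n
  cases n <;> rfl

lemma seqVal_rev {q : ℝ} (hq : 1 < q) (ε : ℕ → Fin 2) :
    seqVal q (fun n => (ε n).rev) = 1 / (q - 1) - seqVal q ε := by
  rw [← (hasSum_inv_pow_succ hq).tsum_eq]
  unfold seqVal
  rw [← (hasSum_inv_pow_succ hq).summable.tsum_sub (summable_digits hq ε)]
  congr 1
  ext i
  rw [← sub_div]
  congr 1
  have hrev : ∀ d : Fin 2, (1 : ℝ) - ((d : ℕ) : ℝ) = ((d.rev : ℕ) : ℝ) := by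
    intro d
    fin_cases d <;> simp [Fin.rev]
  exact (hrev _).symm

/-- Every point of `I_q` has a `q`-expansion, given by the greedy algorithm. -/
lemma exists_seqVal_eq {q : ℝ} (hq : 1 < q) (hq2 : q < 2) {x : ℝ} (hx : x ∈ Iq q) :
    ∃ ε, seqVal q ε = x := by
  have h0 : (0 : ℝ) < q := by linarith
  have hq1 : 0 < q - 1 := by linarith
  let d : ℝ → Fin 2 := fun y => if y < 1 / q then 0 else 1
  let y : ℕ → ℝ := fun n => (fun z => Tmap q (d z) z)^[n] x
  have hstep (n) : y (n + 1) = q * y n - ((d (y n) : ℕ) : ℝ) :=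
    Function.iterate_succ_apply' _ _ _
  have hy : ∀ n, y n ∈ Iq q := by
    intro n
    induction n with
    | zero => exact hx
    | succ n ih =>
      rw [hstep]
      obtain ⟨h1, h2⟩ := ih
      rw [le_div_iff₀ hq1] at h2
      by_cases h : y n < 1 / q
      · simp only [d, h, if_true]
        rw [lt_div_iff₀ h0] at h
        refine ⟨by simp; positivity, ?_⟩
        rw [le_div_iff₀ hq1]
        simp
        nlinarith
      · simp only [d, h, if_false]
        rw [not_lt, div_le_iff₀ h0] at h
        refine ⟨by simp; linarith, ?_⟩
        rw [le_div_iff₀ hq1]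
        simp
        nlinarith
  refine ⟨fun n => d (y n), ?_⟩
  have hpart (n) : ∑ i ∈ Finset.range n, ((d (y i) : ℕ) : ℝ) / q ^ (i + 1)
      = x - y n * (q⁻¹) ^ n := by
    induction n with
    | zero => simp [y]
    | succ n ih =>
      rw [Finset.sum_range_succ, ih, hstep, inv_pow, inv_pow]
      field_simp
      ring
  have hlim := (summable_digits hq fun n => d (y n)).hasSum.tendsto_sum_nat
  refine tendsto_nhds_unique hlim ?_
  simp only [hpart]
  have hpow := tendsto_pow_atTop_nhds_zero_of_lt_one (inv_nonneg.2 h0.le)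
    (inv_lt_one_of_one_lt₀ hq)
  have hz : Filter.Tendsto (fun n => y n * (q⁻¹) ^ n) Filter.atTop (nhds 0) := by
    refine squeeze_zero (fun n => mul_nonneg (hy n).1 (by positivity))
      (fun n => mul_le_mul_of_nonneg_right (hy n).2 (by positivity)) ?_
    simpa using hpow.const_mul (1 / (q - 1))
  simpa using hz.const_sub x

lemma mul_sub_digit_mem_uniqSet {q : ℝ} (hq : 1 < q) (hq2 : q < 2) {y : ℝ} (d : Fin 2)
    (hy : y ∈ UniqSet q) (hd : q * y - ((d : ℕ) : ℝ) ∈ Iq q) :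
    q * y - ((d : ℕ) : ℝ) ∈ UniqSet q := by
  have h0 : (0 : ℝ) < q := by linarith
  obtain ⟨_, _, _, huniq⟩ := hy
  have key : ∀ δ, δ ∈ SigmaSet q (q * y - ((d : ℕ) : ℝ)) → consSeq d δ ∈ SigmaSet q y := by
    intro δ hδ
    change y = _
    rw [seqVal_consSeq hq, ← show q * y - ((d : ℕ) : ℝ) = seqVal q δ from hδ]
    field_simp
    ring
  obtain ⟨ε, hε⟩ := exists_seqVal_eq hq hq2 hd
  refine ⟨hd, ε, hε.symm, fun δ hδ => consSeq_injective d ?_⟩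
  rw [huniq _ (key δ hδ), huniq _ (key ε hε.symm)]

lemma not_mem_switch_of_mem_uniqSet {q : ℝ} (hq : 1 < q) (hq2 : q < 2) {y : ℝ}
    (hy : y ∈ UniqSet q) : y ∉ Sq q := by
  have h0 : (0 : ℝ) < q := by linarith
  have hq1 : 0 < q - 1 := by linarith
  obtain ⟨_, _, _, huniq⟩ := hy
  rintro ⟨h1, h2⟩
  rw [div_le_iff₀ h0] at h1
  rw [le_div_iff₀ (by positivity)] at h2
  have m0 : q * y ∈ Iq q := ⟨by linarith, by rw [le_div_iff₀ hq1]; nlinarith⟩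
  have m1 : q * y - 1 ∈ Iq q := ⟨by linarith, by rw [le_div_iff₀ hq1]; nlinarith⟩
  obtain ⟨ε, hε⟩ := exists_seqVal_eq hq hq2 m0
  obtain ⟨δ, hδ⟩ := exists_seqVal_eq hq hq2 m1
  have e0 : consSeq 0 ε ∈ SigmaSet q y := by
    change y = _
    rw [seqVal_consSeq hq, hε]
    field_simp
    simp
  have e1 : consSeq 1 δ ∈ SigmaSet q y := by
    change y = _
    rw [seqVal_consSeq hq, hδ]
    field_simp
    simp
  have h := (huniq _ e0).trans (huniq _ e1).symm
  exact absurd (congrFun h 0) (show (0 : Fin 2) ≠ 1 by decide)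

lemma head_eq_zero {q : ℝ} (hq : 1 < q) {ε : ℕ → Fin 2} (h : seqVal q ε < 1 / q) : ε 0 = 0 := by
  have h0 : (0 : ℝ) < q := by linarith
  rw [seqVal_eq_head_add_tail hq, div_lt_div_iff_of_pos_right h0] at h
  have := (seqVal_mem_Iq hq fun n => ε (n + 1)).1
  rcases fin_two_cast_cases (ε 0) with h' | h'
  · exact fin_two_cast_injective (by simpa using h')
  · linarith

lemma head_eq_one {q : ℝ} (hq : 1 < q) {ε : ℕ → Fin 2} (h : 1 / (q * (q - 1)) < seqVal q ε) :
    ε 0 = 1 := by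
  have h0 : (0 : ℝ) < q := by linarith
  rw [seqVal_eq_head_add_tail hq, mul_comm, ← div_div, div_lt_div_iff_of_pos_right h0] at h
  have := (seqVal_mem_Iq hq fun n => ε (n + 1)).2
  rcases fin_two_cast_cases (ε 0) with h' | h'
  · linarith
  · exact fin_two_cast_injective (by simpa using h')

lemma mem_uniqSet_of_mul_mem {q : ℝ} (hq : 1 < q) {y : ℝ} (hy : y < 1 / q)
    (h : q * y ∈ UniqSet q) : y ∈ UniqSet q := by
  have h0 : (0 : ℝ) < q := by linarith
  obtain ⟨_, ε, hε, huniq⟩ := h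
  have hε' : y = seqVal q (consSeq 0 ε) := by
    rw [seqVal_consSeq hq, ← show q * y = seqVal q ε from hε]
    field_simp
    simp
  refine ⟨hε' ▸ seqVal_mem_Iq hq _, consSeq 0 ε, hε', fun δ hδ => ?_⟩
  have hδ' : y = seqVal q δ := hδ
  have hd : δ 0 = 0 := head_eq_zero hq (hδ' ▸ hy)
  rw [← consSeq_head_tail δ, hd]
  congr 1
  apply huniq
  change q * y = _
  rw [hδ', seqVal_eq_head_add_tail hq, hd]
  field_simp
  simp

lemma rev_mem_uniqSet {q : ℝ} (hq : 1 < q) {y : ℝ} (h : y ∈ UniqSet q) :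
    1 / (q - 1) - y ∈ UniqSet q := by
  obtain ⟨_, ε, hε, huniq⟩ := h
  have hε : y = seqVal q ε := hε
  have he : 1 / (q - 1) - y = seqVal q (fun n => (ε n).rev) := by rw [seqVal_rev hq, hε]
  refine ⟨he ▸ seqVal_mem_Iq hq _, _, he, fun δ hδ => ?_⟩
  have hδ : 1 / (q - 1) - y = seqVal q δ := hδ
  rw [← huniq (fun n => (δ n).rev) (show y = _ by rw [seqVal_rev hq, ← hδ]; ring)]
  simp

/-- The points `((01)^∞)_q` and `((10)^∞)_q` have at most one expansion when `q` exceeds the golden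
ratio. -/
lemma expansion_unique_of_alternating {q : ℝ} (hq : 1 < q) (hg : q + 1 < q ^ 2) (n : ℕ) :
    ∀ ε δ : ℕ → Fin 2, seqVal q ε = seqVal q δ →
      (seqVal q ε = 1 / (q ^ 2 - 1) ∨ seqVal q ε = q / (q ^ 2 - 1)) → ε n = δ n := by
  have h0 : (0 : ℝ) < q := by linarith
  have hq1 : 0 < q - 1 := by linarith
  have hq2 : 0 < q ^ 2 - 1 := by linarith
  induction n with
  | zero =>
    rintro ε δ h (h' | h')
    · have : seqVal q ε < 1 / q := by
        rw [h', div_lt_div_iff₀ hq2 h0]; linarith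
      rw [head_eq_zero hq this, head_eq_zero hq (ε := δ) (h ▸ this)]
    · have : 1 / (q * (q - 1)) < seqVal q ε := by
        rw [h', div_lt_div_iff₀ (by positivity) hq2]; nlinarith
      rw [head_eq_one hq this, head_eq_one hq (ε := δ) (h ▸ this)]
  | succ n ih =>
    intro ε δ h h'
    have hd : ε 0 = δ 0 ∧ (seqVal q (fun n => ε (n + 1)) = 1 / (q ^ 2 - 1) ∨
        seqVal q (fun n => ε (n + 1)) = q / (q ^ 2 - 1)) := by
      have e := seqVal_eq_head_add_tail hq ε
      rcases h' with h' | h'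
      · have : seqVal q ε < 1 / q := by
          rw [h', div_lt_div_iff₀ hq2 h0]; linarith
        refine ⟨by rw [head_eq_zero hq this, head_eq_zero hq (ε := δ) (h ▸ this)], Or.inr ?_⟩
        rw [h', head_eq_zero hq this] at e
        field_simp at e ⊢
        simp at e
        linarith
      · have : 1 / (q * (q - 1)) < seqVal q ε := by
          rw [h', div_lt_div_iff₀ (by positivity) hq2]; nlinarith
        refine ⟨by rw [head_eq_one hq this, head_eq_one hq (ε := δ) (h ▸ this)], Or.inl ?_⟩
        rw [h', head_eq_one hq this] at e
        field_simp at e ⊢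
        simp at e
        linarith
    refine ih (fun n => ε (n + 1)) (fun n => δ (n + 1)) ?_ hd.2
    rw [seqVal_eq_head_add_tail hq ε, seqVal_eq_head_add_tail hq δ, hd.1,
      div_left_inj' h0.ne', add_right_inj] at h
    exact h

lemma inv_pow_mul_mem_uniqSet {q : ℝ} (hq : 1 < q) (hq2 : q < 2) (hg : q + 1 < q ^ 2) (j : ℕ) :
    1 / (q ^ j * (q ^ 2 - 1)) ∈ UniqSet q := by
  have h0 : (0 : ℝ) < q := by linarith
  have hs : 0 < q ^ 2 - 1 := by linarith
  have hq1 : 0 < q - 1 := by linarith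
  induction j with
  | zero =>
    have hm : 1 / (q ^ 2 - 1) ∈ Iq q :=
      ⟨by positivity, one_div_le_one_div_of_le hq1 (by nlinarith)⟩
    rw [pow_zero, one_mul]
    obtain ⟨ε, hε⟩ := exists_seqVal_eq hq hq2 hm
    refine ⟨hm, ε, hε.symm, fun δ hδ => funext fun n => ?_⟩
    have hδ : _ = seqVal q δ := hδ
    exact expansion_unique_of_alternating hq hg n δ ε (by rw [hε, hδ]) (Or.inl hδ.symm)
  | succ j ih =>
    apply mem_uniqSet_of_mul_mem hq
    · apply one_div_lt_one_div_of_lt h0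
      have := one_le_pow₀ hq.le (n := j + 1)
      nlinarith
    · convert ih using 1
      rw [pow_succ]
      field_simp

/-- Below the base `q_f` (given by `q³ = 2q² - q + 1`), the only point of `U_q` to the right of the
switch region and less than `1` is `((10)^∞)_q`. -/
lemma eq_of_mem_uniqSet_of_lt_one {q : ℝ} (hq : 1 < q) (hq2 : q < 2)
    (hf : q ^ 3 - 2 * q ^ 2 + q - 1 < 0) {z : ℝ} (hz : z ∈ UniqSet q)
    (hz1 : 1 / (q * (q - 1)) < z) (hz2 : z < 1) : z = q / (q ^ 2 - 1) := by
  have h0 : (0 : ℝ) < q := by linarith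
  have hq1 : 0 < q - 1 := by linarith
  have hs : 0 < q ^ 2 - 1 := by nlinarith
  set c := q / (q ^ 2 - 1) with hc
  let P : ℝ → Prop := fun z => z ∈ UniqSet q ∧ 1 / (q * (q - 1)) < z ∧ z < 1
  have hP : ∀ z, P z → P (c + q ^ 2 * (z - c)) := by
    rintro z ⟨hz, hz1, hz2⟩
    have hcz : c + q ^ 2 * (z - c) = q * (q * z - 1) := by
      rw [hc]; field_simp; ring
    rw [hcz]
    rw [div_lt_iff₀ (by positivity)] at hz1
    have m1 : q * z - 1 ∈ UniqSet q := by
      simpa using mul_sub_digit_mem_uniqSet hq hq2 1 hz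
        (by refine ⟨?_, ?_⟩ <;> simp only [Fin.val_one, Nat.cast_one]
            · nlinarith
            · have : q * z - 1 < q - 1 := by nlinarith
              rw [le_div_iff₀ hq1]
              nlinarith)
    have l1 : q * z - 1 < 1 / q := by
      by_contra! h
      apply not_mem_switch_of_mem_uniqSet hq hq2 m1
      refine ⟨h, ?_⟩
      rw [le_div_iff₀ (by positivity)]
      have : (q * z - 1) * (q * (q - 1)) ≤ (q - 1) * (q * (q - 1)) :=
        mul_le_mul_of_nonneg_right (by nlinarith) (by positivity)
      nlinarith
    have m2 : q * (q * z - 1) ∈ UniqSet q := by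
      simpa using mul_sub_digit_mem_uniqSet hq hq2 0 m1
        (by simp only [Fin.val_zero, Nat.cast_zero, sub_zero]
            refine ⟨mul_nonneg h0.le m1.1.1, ?_⟩
            rw [lt_div_iff₀ h0] at l1
            rw [le_div_iff₀ hq1]; nlinarith)
    refine ⟨m2, ?_, by rw [lt_div_iff₀ h0] at l1; linarith⟩
    by_contra! h
    apply not_mem_switch_of_mem_uniqSet hq hq2 m2
    refine ⟨?_, h⟩
    rw [div_le_iff₀ h0]
    have : q * (q - 1) * (q * z - 1) > q * (2 - q) := by nlinarith
    have : q * (q - 1) * (q * z - 1) * q > q * (2 - q) * q := by nlinarith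
    have h3 : (q * (q * z - 1) * q) * (q - 1) ≥ 1 * (q - 1) := by nlinarith
    exact le_of_mul_le_mul_right h3 hq1
  have hiter : ∀ n, P (c + (q ^ 2) ^ n * (z - c)) := by
    intro n
    induction n with
    | zero => simpa using ⟨hz, by simpa using hz1, hz2⟩
    | succ n ih =>
      have := hP _ ih
      rwa [add_sub_cancel_left, ← mul_assoc, ← pow_succ'] at this
  by_contra hne
  have hpos : 0 < |z - c| := abs_pos.2 (sub_ne_zero.2 hne)
  obtain ⟨n, hn⟩ := pow_unbounded_of_one_lt ((1 + |c|) / |z - c|) (show 1 < q ^ 2 by linarith)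
  rw [div_lt_iff₀ hpos] at hn
  obtain ⟨_, h1, h2⟩ := hiter n
  have h3 : 0 < 1 / (q * (q - 1)) := by positivity
  have h4 : |(q ^ 2) ^ n * (z - c)| ≤ 1 + |c| := by
    have := neg_abs_le c
    have := le_abs_self c
    rw [abs_le]
    constructor <;> linarith
  rw [abs_mul, abs_of_pos (by positivity : 0 < (q ^ 2) ^ n)] at h4
  linarith

/-- The normalised sum comparing `q` with `α_j`: it is at most `1` exactly when `α_j ≤ q`. -/
def alphaSum (j : ℕ) (x : ℝ) : ℝ :=
  ∑ i ∈ Finset.range j, (1 / x ^ (i + 2) + 1 / x ^ (i + 4))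

lemma alphaSum_identity {x : ℝ} (hx : 0 < x) (j : ℕ) :
    (x - 1) * x ^ (j + 3) * (1 - alphaSum j x) =
      x ^ (j + 4) - x ^ (j + 3) - x ^ (j + 2) - x ^ j + x ^ 2 + 1 := by
  induction j with
  | zero => simp [alphaSum]; ring
  | succ j ih =>
    have e : alphaSum (j + 1) x = alphaSum j x + (1 / x ^ (j + 2) + 1 / x ^ (j + 4)) :=
      Finset.sum_range_succ _ _
    have : (x - 1) * x ^ (j + 1 + 3) * (1 - alphaSum (j + 1) x) =
        x * ((x - 1) * x ^ (j + 3) * (1 - alphaSum j x)) - (x - 1) * (x ^ 2 + 1) := by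
      rw [e]
      field_simp
      ring
    rw [this, ih]
    ring

lemma alphaSum_mono {x : ℝ} (hx : 0 < x) {i j : ℕ} (h : i ≤ j) : alphaSum i x ≤ alphaSum j x :=
  Finset.sum_le_sum_of_subset_of_nonneg (Finset.range_mono h) fun _ _ _ => by positivity

lemma alphaSum_anti {x y : ℝ} (hx : 0 < x) (h : x ≤ y) (j : ℕ) : alphaSum j y ≤ alphaSum j x :=
  Finset.sum_le_sum fun _ _ => by gcongr

lemma alphaSum_strictAnti {x y : ℝ} (hx : 0 < x) (h : x < y) (j : ℕ) :
    alphaSum (j + 1) y < alphaSum (j + 1) x :=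
  Finset.sum_lt_sum_of_nonempty (by simp) fun _ _ => by gcongr

lemma alphaSum_eq_one {x : ℝ} (hx : 1 < x) {j : ℕ}
    (h : x ^ (j + 4) = x ^ (j + 3) + x ^ (j + 2) + x ^ j - x ^ 2 - 1) : alphaSum j x = 1 := by
  have h0 : 0 < x := by linarith
  have e := alphaSum_identity h0 j
  have hp : (x - 1) * x ^ (j + 3) ≠ 0 := mul_ne_zero (by linarith) (by positivity)
  have : (x - 1) * x ^ (j + 3) * (1 - alphaSum j x) = 0 := by rw [e]; linarith
  have := (mul_eq_zero.1 this).resolve_left hp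
  linarith

lemma lower_bound_iff {q : ℝ} (hq : 1 < q) (j : ℕ) :
    (q + q ^ 2) / (q ^ 4 - 1) ≤ (1 + 1 / (q ^ j * (q ^ 2 - 1))) / q ↔ alphaSum j q ≤ 1 := by
  have h0 : (0 : ℝ) < q := by linarith
  have hs : 0 < q ^ 2 - 1 := by nlinarith
  have h4 : 0 < q ^ 4 - 1 := by nlinarith
  have hp : 0 < (q - 1) * q ^ (j + 3) := mul_pos (by linarith) (by positivity)
  have e := alphaSum_identity h0 j
  have e2 : (1 + 1 / (q ^ j * (q ^ 2 - 1))) / q - (q + q ^ 2) / (q ^ 4 - 1) =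
      ((q - 1) * q ^ (j + 3) * (1 - alphaSum j q)) / (q ^ j * q * (q ^ 4 - 1)) := by
    rw [e]
    field_simp
    ring
  rw [← sub_nonneg, e2, le_div_iff₀ (by positivity), zero_mul,
    mul_nonneg_iff_of_pos_left hp, sub_nonneg]

lemma tail_uwInf_cons (a : Fin 2) (u w : List (Fin 2)) :
    (fun n => uwInf (a :: u) w (n + 1)) = uwInf u w := by
  ext n
  simp [uwInf]

lemma seqVal_uwInf_nil {q : ℝ} (hq : 1 < q) :
    seqVal q (uwInf [] [0, 1]) = 1 / (q ^ 2 - 1) := by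
  have h0 : (0 : ℝ) < q := by linarith
  have hs : 0 < q ^ 2 - 1 := by nlinarith
  have h := seqVal_eq_head_add_tail hq (uwInf [] [0, 1])
  rw [seqVal_eq_head_add_tail hq (fun n => uwInf [] [0, 1] (n + 1))] at h
  have e : (fun n => (fun n => uwInf [] [0, 1] (n + 1)) (n + 1)) = uwInf [] [0, 1] := by
    ext n
    simp [uwInf, Nat.add_assoc]
  rw [e] at h
  simp only [uwInf, List.length_nil] at h ⊢
  simp at h ⊢
  field_simp at h ⊢
  linarith

lemma seqVal_uwInf_replicate {q : ℝ} (hq : 1 < q) (j : ℕ) :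
    seqVal q (uwInf (List.replicate j 0) [0, 1]) = 1 / (q ^ j * (q ^ 2 - 1)) := by
  have h0 : (0 : ℝ) < q := by linarith
  have hs : 0 < q ^ 2 - 1 := by nlinarith
  induction j with
  | zero => simpa using seqVal_uwInf_nil hq
  | succ j ih =>
    rw [List.replicate_succ, seqVal_eq_head_add_tail hq, tail_uwInf_cons, ih, pow_succ]
    simp [uwInf]
    field_simp
    ring

lemma seqVal_uwInf_one_replicate {q : ℝ} (hq : 1 < q) (j : ℕ) :
    seqVal q (uwInf (1 :: List.replicate j 0) [0, 1]) =
      (1 + 1 / (q ^ j * (q ^ 2 - 1))) / q := by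
  rw [seqVal_eq_head_add_tail hq, tail_uwInf_cons, seqVal_uwInf_replicate hq]
  simp [uwInf]

lemma getD_map_rev (l : List (Fin 2)) (i : ℕ) (h : i < l.length) :
    (l.map Fin.rev).getD i 0 = (l.getD i 0).rev := by
  simp [List.getD, h]

lemma uwInf_map_rev (u w : List (Fin 2)) (hw : 0 < w.length) :
    uwInf (u.map Fin.rev) (w.map Fin.rev) = fun n => (uwInf u w n).rev := by
  ext n
  simp only [uwInf, List.length_map]
  split_ifs with h
  · rw [getD_map_rev _ _ h]
  · rw [getD_map_rev _ _ (Nat.mod_lt _ hw)]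

lemma seqVal_uwInf_zero_replicate {q : ℝ} (hq : 1 < q) (j : ℕ) :
    seqVal q (uwInf (0 :: List.replicate j 1) [1, 0]) =
      1 / (q - 1) - seqVal q (uwInf (1 :: List.replicate j 0) [0, 1]) := by
  rw [← seqVal_rev hq, ← uwInf_map_rev _ _ (by simp)]
  congr 2
  simp

/-- The points of `J_q` whose image under `T_{q,1}` lies in `U_q`. -/
lemma mem_inter_Jq_iff {k : ℕ} {q : ℝ} (hq : 1 < q) (hq2 : q < 2) (hg : q + 1 < q ^ 2)
    (hk : alphaSum k q ≤ 1) (hk1 : 1 < alphaSum (k + 1) q)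
    (x : ℝ) : (q * x - 1 ∈ UniqSet q ∧ x ∈ Jq q) ↔
      ∃ j : ℕ, 1 ≤ j ∧ j ≤ k ∧ x = (1 + 1 / (q ^ j * (q ^ 2 - 1))) / q := by
  have h0 : (0 : ℝ) < q := by linarith
  have hq1 : 0 < q - 1 := by linarith
  have hs : 0 < q ^ 2 - 1 := by linarith
  have h4 : 0 < q ^ 4 - 1 := by nlinarith
  constructor
  · rintro ⟨hU, hJ1, hJ2⟩
    have hg4 : q ^ 4 - q ^ 3 - q ^ 2 - 1 < 0 := by
      have e := alphaSum_identity h0 (k + 1)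
      have hneg : (q - 1) * q ^ (k + 1 + 3) * (1 - alphaSum (k + 1) q) < 0 :=
        mul_neg_of_pos_of_neg (mul_pos hq1 (by positivity)) (by linarith)
      rw [e] at hneg
      have : q ^ (k + 1) * (q ^ 4 - q ^ 3 - q ^ 2 - 1) < q ^ (k + 1) * 0 := by
        ring_nf at hneg ⊢
        nlinarith
      exact lt_of_mul_lt_mul_left this (by positivity)
    have hf : q ^ 3 - 2 * q ^ 2 + q - 1 < 0 := by
      have : (q + 1) * (q ^ 3 - 2 * q ^ 2 + q - 1) < (q + 1) * 0 := by
        ring_nf at hg4 ⊢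
        linarith
      exact lt_of_mul_lt_mul_left this (by linarith)
    set y := q * x - 1 with hy
    have hx : x = (1 + y) / q := by rw [hy]; field_simp; ring
    have hy0 : 0 ≤ y := hU.1.1
    have hyle : y * (q ^ 4 - 1) ≤ q + 1 := by
      rw [le_div_iff₀ h4] at hJ2
      rw [hy]
      nlinarith
    have hyne : 0 < y := by
      refine lt_of_le_of_ne hy0 fun h => ?_
      rw [hx, ← h, div_le_div_iff₀ h4 h0] at hJ1
      nlinarith
    have hylt : y < 1 / q := by
      rw [lt_div_iff₀ h0]
      by_contra! h
      have h5 : q ^ 4 - 1 ≤ q * (q + 1) := by nlinarith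
      nlinarith [mul_pos h0 hq1, mul_pos (mul_pos h0 h0) hq1]
    have hex : ∃ n : ℕ, 1 / q ≤ q ^ n * y := by
      obtain ⟨n, hn⟩ := pow_unbounded_of_one_lt ((1 / q) / y) hq
      exact ⟨n, ((div_lt_iff₀ hyne).1 hn).le⟩
    classical
    obtain ⟨n, hn, hmin⟩ : ∃ n : ℕ, 1 / q ≤ q ^ (n + 1) * y ∧ ∀ m ≤ n, q ^ m * y < 1 / q := by
      have hpos : Nat.find hex ≠ 0 := by
        intro h
        have := Nat.find_spec hex
        rw [h, pow_zero, one_mul] at this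
        linarith
      obtain ⟨n, hn⟩ := Nat.exists_eq_succ_of_ne_zero hpos
      refine ⟨n, ?_, fun m hm => ?_⟩
      · have := Nat.find_spec hex
        rwa [hn] at this
      · exact not_le.1 (Nat.find_min hex (by omega))
    have hmem : ∀ m ≤ n + 1, q ^ m * y ∈ UniqSet q := by
      intro m
      induction m with
      | zero => intro _; simpa using hU
      | succ m ih =>
        intro hm
        have hlt := hmin m (by omega)
        rw [lt_div_iff₀ h0] at hlt
        have := mul_sub_digit_mem_uniqSet hq hq2 0 (ih (by omega))
          ⟨by simp; positivity, by
            simp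
            rw [← one_div, le_div_iff₀ hq1]
            nlinarith⟩
        simp at this
        rwa [← mul_assoc, ← pow_succ'] at this
    have hz1 : 1 / (q * (q - 1)) < q ^ (n + 1) * y := by
      by_contra! h
      exact not_mem_switch_of_mem_uniqSet hq hq2 (hmem _ le_rfl) ⟨hn, h⟩
    have hz2 : q ^ (n + 1) * y < 1 := by
      have := hmin n le_rfl
      rw [lt_div_iff₀ h0] at this
      rw [pow_succ]
      linarith
    have hz := eq_of_mem_uniqSet_of_lt_one hq hq2 hf (hmem _ le_rfl) hz1 hz2
    have hyv : y = 1 / (q ^ n * (q ^ 2 - 1)) := by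
      rw [pow_succ] at hz
      field_simp at hz ⊢
      linarith
    have hxv : x = (1 + 1 / (q ^ n * (q ^ 2 - 1))) / q := by rw [hx, hyv]
    refine ⟨n, ?_, ?_, hxv⟩
    · rw [Nat.one_le_iff_ne_zero]
      rintro rfl
      have : y * (q ^ 4 - 1) = q ^ 2 + 1 := by
        rw [hyv]; field_simp; ring
      nlinarith
    · by_contra! h
      rw [hxv, lower_bound_iff hq] at hJ1
      have := alphaSum_mono h0 (show k + 1 ≤ n from h)
      linarith
  · rintro ⟨j, hj1, hjk, rfl⟩
    refine ⟨?_, (lower_bound_iff hq j).2 ((alphaSum_mono h0 hjk).trans hk), ?_⟩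
    · convert inv_pow_mul_mem_uniqSet hq hq2 hg j using 1
      field_simp
      ring
    · have hp : q ≤ q ^ j := le_self_pow₀ hq.le (by omega)
      have : 1 / (q ^ j * (q ^ 2 - 1)) ≤ 1 / (q * (q ^ 2 - 1)) := by gcongr
      calc (1 + 1 / (q ^ j * (q ^ 2 - 1))) / q ≤ (1 + 1 / (q * (q ^ 2 - 1))) / q := by gcongr
        _ ≤ (1 + q ^ 3) / (q ^ 4 - 1) := by
          rw [← sub_nonneg]
          have : (1 + q ^ 3) / (q ^ 4 - 1) - (1 + 1 / (q * (q ^ 2 - 1))) / q =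
              (q - 1) / (q ^ 2 * (q ^ 4 - 1)) := by
            field_simp
            ring
          rw [this]
          positivity

lemma golden_lt_of_alphaSum_le_one {q : ℝ} (hq : 1 < q) (h : alphaSum 3 q ≤ 1) :
    q + 1 < q ^ 2 := by
  have h0 : (0 : ℝ) < q := by linarith
  have e : alphaSum 3 q = (q ^ 4 + q ^ 3 + 2 * q ^ 2 + q + 1) / q ^ 6 := by
    simp [alphaSum, Finset.sum_range_succ]
    field_simp
    ring
  rw [e, div_le_one (by positivity)] at h
  by_contra! hc
  have h2 : q ^ 6 ≤ q ^ 5 + q ^ 4 := by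
    have := mul_le_mul_of_nonneg_left hc (by positivity : 0 ≤ q ^ 4); linarith
  have h3 : q ^ 5 ≤ q ^ 4 + q ^ 3 := by
    have := mul_le_mul_of_nonneg_left hc (by positivity : 0 ≤ q ^ 3); linarith
  have h4 : q ^ 4 ≤ q ^ 3 + q ^ 2 := by
    have := mul_le_mul_of_nonneg_left hc (by positivity : 0 ≤ q ^ 2); linarith
  have h5 : q ^ 3 ≤ q ^ 2 + q := by
    have := mul_le_mul_of_nonneg_left hc h0.le; linarith
  linarith

lemma rev_mem_uniqSet_iff {q : ℝ} (hq : 1 < q) (y : ℝ) :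
    1 / (q - 1) - y ∈ UniqSet q ↔ y ∈ UniqSet q :=
  ⟨fun h => by simpa using rev_mem_uniqSet hq h, rev_mem_uniqSet hq⟩

lemma rev_mem_Jq_iff {q : ℝ} (hq : 1 < q) (x : ℝ) : 1 / (q - 1) - x ∈ Jq q ↔ x ∈ Jq q := by
  have h4 : q ^ 4 - 1 ≠ 0 := by nlinarith [one_lt_pow₀ hq (n := 4) (by norm_num)]
  have hq1 : q - 1 ≠ 0 := by linarith
  have e : 1 / (q - 1) = (q + q ^ 2) / (q ^ 4 - 1) + (1 + q ^ 3) / (q ^ 4 - 1) := by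
    field_simp
    ring
  rw [e]
  simp only [Jq, mem_Icc]
  constructor <;> rintro ⟨h1, h2⟩ <;> constructor <;> linarith

/-- For `k ≥ 3` and `q ∈ [α_k, α_{k+1})`,
`(T_{q,0}⁻¹(U_q) ∩ J_q) ∪ (T_{q,1}⁻¹(U_q) ∩ J_q)`
`= {(1(0)^j(01)^∞)_q : 1 ≤ j ≤ k} ∪ {(0(1)^j(10)^∞)_q : 1 ≤ j ≤ k}`. -/
theorem Pq_in_alpha_interval
    (k : ℕ) (hk : 3 ≤ k)
    (αk : ℝ) (hαk1 : αk ∈ Set.Ioo (1 : ℝ) 2)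
    (hαk2 : αk ^ (k + 4) = αk ^ (k + 3) + αk ^ (k + 2) + αk ^ k - αk ^ 2 - 1)
    (αk1 : ℝ) (hαk11 : αk1 ∈ Set.Ioo (1 : ℝ) 2)
    (hαk12 : αk1 ^ (k + 5) = αk1 ^ (k + 4) + αk1 ^ (k + 3) + αk1 ^ (k + 1) - αk1 ^ 2 - 1)
    (q : ℝ) (hq : q ∈ Set.Ico αk αk1) :
    (Tmap q 0 ⁻¹' UniqSet q ∩ Jq q) ∪ (Tmap q 1 ⁻¹' UniqSet q ∩ Jq q) =
      {x | ∃ j : ℕ, 1 ≤ j ∧ j ≤ k ∧ x = seqVal q (uwInf (1 :: List.replicate j 0) [0, 1])} ∪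
      {x | ∃ j : ℕ, 1 ≤ j ∧ j ≤ k ∧ x = seqVal q (uwInf (0 :: List.replicate j 1) [1, 0])} := by
  obtain ⟨hqa, hqb⟩ := hq
  have ha1 : 1 < αk := hαk1.1
  have hq1 : 1 < q := lt_of_lt_of_le ha1 hqa
  have hq2 : q < 2 := hqb.trans hαk11.2
  have h0 : 0 < q := by linarith
  have hSk : alphaSum k q ≤ 1 := by
    rw [← alphaSum_eq_one ha1 hαk2]
    exact alphaSum_anti (by linarith) hqa k
  have hSk1 : 1 < alphaSum (k + 1) q := by
    rw [← alphaSum_eq_one (j := k + 1) hαk11.1 hαk12]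
    exact alphaSum_strictAnti h0 hqb k
  have hg := golden_lt_of_alphaSum_le_one hq1 ((alphaSum_mono h0 hk).trans hSk)
  have key := mem_inter_Jq_iff hq1 hq2 hg hSk hSk1
  rw [union_comm]
  congr 1
  · ext x
    simp only [mem_inter_iff, mem_preimage, Tmap, mem_ofPred_eq, seqVal_uwInf_one_replicate hq1,
      ← key x]
    simp
  · ext x
    have h := key (1 / (q - 1) - x)
    have e : q * (1 / (q - 1) - x) - 1 = 1 / (q - 1) - q * x := by
      have : q - 1 ≠ 0 := by linarith
      field_simp
      ring
    rw [e, rev_mem_uniqSet_iff hq1, rev_mem_Jq_iff hq1] at h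
    simp only [mem_inter_iff, mem_preimage, Tmap, mem_ofPred_eq, seqVal_uwInf_zero_replicate hq1,
      seqVal_uwInf_one_replicate hq1]
    simp only [Fin.val_zero, Nat.cast_zero, sub_zero]
    rw [h]
    constructor <;> rintro ⟨j, h1, h2, h3⟩ <;> exact ⟨j, h1, h2, by linarith⟩
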